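/- arXiv:quant-ph/9907081 — 2 statements merged into one kernel-verified Lean document; each statement's English description precedes it below -/
import Mathlib

section
/- Quantum Data Processing Inequality: let W_* : A₁ → A₂ and D_* : A₂ → A₃ be trace-preserving completely positive maps of finite-dimensional C*-algebras and A ∈ A₁⁺ a density operator with spectral decomposition A = Σ_a a |a><a|. Define the joint state (A, W_*(A)) = Σ_a a |a><a| ⊗ W_*(|a><a|) and mutual information I(A; W_*) = H(A) + H(W_*(A)) − H(A, W_*(A)) with H(X) = −tr(X log X). Then I(A; D_* ∘ W_*) ≤ I(A; W_*). -/
open Matrix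
open scoped ComplexOrder Kronecker

/-- The amplification `Φ ⊗ 1_k` of a linear map of matrix algebras, acting on block
matrices. -/
def ampMap {n m : ℕ} (Φ : Matrix (Fin n) (Fin n) ℂ →ₗ[ℂ] Matrix (Fin m) (Fin m) ℂ)
    (k : ℕ) (M : Matrix (Fin k × Fin n) (Fin k × Fin n) ℂ) :
    Matrix (Fin k × Fin m) (Fin k × Fin m) ℂ :=
  fun p q => Φ (Matrix.of fun i j => M (p.1, i) (q.1, j)) p.2 q.2

/-- A linear map of matrix algebras is completely positive if all its amplifications
preserve positive semidefiniteness. -/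
def IsCompletelyPositive {n m : ℕ}
    (Φ : Matrix (Fin n) (Fin n) ℂ →ₗ[ℂ] Matrix (Fin m) (Fin m) ℂ) : Prop :=
  ∀ (k : ℕ) (M : Matrix (Fin k × Fin n) (Fin k × Fin n) ℂ),
    M.PosSemidef → (ampMap Φ k M).PosSemidef

/-- A quantum channel: trace preserving and completely positive. -/
def IsQuantumChannel {n m : ℕ}
    (Φ : Matrix (Fin n) (Fin n) ℂ →ₗ[ℂ] Matrix (Fin m) (Fin m) ℂ) : Prop :=
  IsCompletelyPositive Φ ∧ ∀ x, (Φ x).trace = x.trace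

open Classical in
/-- Matrix logarithm via functional calculus, taken to be `0` on the kernel. -/
noncomputable def matLog {k : Type*} [Fintype k] [DecidableEq k]
    (ρ : Matrix k k ℂ) : Matrix k k ℂ :=
  if h : ρ.IsHermitian then h.cfc (fun t : ℝ => if t = 0 then 0 else Real.log t) else 0

/-- Shannon–von Neumann entropy `H(X) = -tr(X log X)`. -/
noncomputable def vNent {k : Type*} [Fintype k] [DecidableEq k]
    (X : Matrix k k ℂ) : ℝ :=
  -((X * matLog X).trace.re)

open Classical in
/-- The joint input–output state `(A, B) = Σ_a a |a⟩⟨a| ⊗ W(|a⟩⟨a|)` of a channel `W`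
applied to a state `A` with spectral decomposition `A = Σ_a a |a⟩⟨a|`. -/
noncomputable def jointState {n m : ℕ} (ρ : Matrix (Fin n) (Fin n) ℂ)
    (W : Matrix (Fin n) (Fin n) ℂ →ₗ[ℂ] Matrix (Fin m) (Fin m) ℂ) :
    Matrix (Fin n × Fin m) (Fin n × Fin m) ℂ :=
  if h : ρ.IsHermitian then
    ∑ a : Fin n, (h.eigenvalues a : ℂ) •
      (Matrix.vecMulVec (fun i => (h.eigenvectorUnitary : Matrix (Fin n) (Fin n) ℂ) i a)
          (fun j => star ((h.eigenvectorUnitary : Matrix (Fin n) (Fin n) ℂ) j a)) ⊗ₖ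
        W (Matrix.vecMulVec
          (fun i => (h.eigenvectorUnitary : Matrix (Fin n) (Fin n) ℂ) i a)
          (fun j => star ((h.eigenvectorUnitary : Matrix (Fin n) (Fin n) ℂ) j a))))
  else 0

/-- Mutual information `I(A; W) = H(A) + H(W(A)) − H(A, W(A))`. -/
noncomputable def mutInfo {n m : ℕ} (ρ : Matrix (Fin n) (Fin n) ℂ)
    (W : Matrix (Fin n) (Fin n) ℂ →ₗ[ℂ] Matrix (Fin m) (Fin m) ℂ) : ℝ :=
  vNent ρ + vNent (W ρ) - vNent (jointState ρ W)


namespace QDPI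

lemma amp_posSemidef {n m : ℕ} {Φ : Matrix (Fin n) (Fin n) ℂ →ₗ[ℂ] Matrix (Fin m) (Fin m) ℂ}
    (hΦ : IsCompletelyPositive Φ) {σ : Matrix (Fin n) (Fin n) ℂ} (hσ : σ.PosSemidef)
    (f : Fin 2 → Matrix (Fin n) (Fin n) ℂ) :
    (Matrix.of fun (p q : Fin 2 × Fin m) => Φ ((f p.1)ᴴ * σ * f q.1) p.2 q.2).PosSemidef := by
  have h := hΦ 2 _ (hσ.conjTranspose_mul_mul_same
    (Matrix.of fun (i : Fin n) (p : Fin 2 × Fin n) => f p.1 i p.2))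
  exact h

lemma chan_posSemidef {n m : ℕ} {Φ : Matrix (Fin n) (Fin n) ℂ →ₗ[ℂ] Matrix (Fin m) (Fin m) ℂ}
    (hΦ : IsCompletelyPositive Φ) {σ : Matrix (Fin n) (Fin n) ℂ} (hσ : σ.PosSemidef) :
    (Φ σ).PosSemidef := by
  have h := (amp_posSemidef hΦ hσ (fun _ => 1)).submatrix (fun i : Fin m => ((0 : Fin 2), i))
  convert h using 1
  ext i j
  simp

lemma chan_conjTranspose {n m : ℕ} {Φ : Matrix (Fin n) (Fin n) ℂ →ₗ[ℂ] Matrix (Fin m) (Fin m) ℂ}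
    (hΦ : IsCompletelyPositive Φ) (A : Matrix (Fin n) (Fin n) ℂ) :
    Φ Aᴴ = (Φ A)ᴴ := by
  have h := (amp_posSemidef hΦ (Matrix.PosSemidef.one (n := Fin n) (R := ℂ)) ![A, 1]).isHermitian
  ext i j
  have := congrFun (congrFun h (0, i)) (1, j)
  simpa using this.symm

lemma chan_sum_nonneg {n m : ℕ} {Φ : Matrix (Fin n) (Fin n) ℂ →ₗ[ℂ] Matrix (Fin m) (Fin m) ℂ}
    (hΦ : IsCompletelyPositive Φ) {σ : Matrix (Fin n) (Fin n) ℂ} (hσ : σ.PosSemidef)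
    (f : Fin 2 → Matrix (Fin n) (Fin n) ℂ) (g : Fin 2 → Matrix (Fin m) (Fin m) ℂ) :
    0 ≤ ∑ b, ∑ a, ((g a)ᴴ * Φ ((f a)ᴴ * σ * f b) * g b).trace := by
  have h := ((amp_posSemidef hΦ hσ f).conjTranspose_mul_mul_same
    (Matrix.of fun (p : Fin 2 × Fin m) (i : Fin m) => g p.1 p.2 i)).trace_nonneg
  convert h using 1
  simp only [Matrix.trace, Matrix.diag, Matrix.mul_apply, Fintype.sum_prod_type, Matrix.of_apply,
    Matrix.conjTranspose_apply, Fin.sum_univ_two, Finset.sum_add_distrib, add_mul]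

/-- The trace dual of a linear map. -/
noncomputable def dual {n m : ℕ} (Φ : Matrix (Fin n) (Fin n) ℂ →ₗ[ℂ] Matrix (Fin m) (Fin m) ℂ)
    (Y : Matrix (Fin m) (Fin m) ℂ) : Matrix (Fin n) (Fin n) ℂ :=
  Matrix.of fun j i => (Φ (Matrix.single i j 1) * Y).trace

lemma dual_spec {n m : ℕ} (Φ : Matrix (Fin n) (Fin n) ℂ →ₗ[ℂ] Matrix (Fin m) (Fin m) ℂ)
    (X : Matrix (Fin n) (Fin n) ℂ) (Y : Matrix (Fin m) (Fin m) ℂ) :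
    (Φ X * Y).trace = (X * dual Φ Y).trace := by
  conv_lhs => rw [Matrix.matrix_eq_sum_single X]
  simp only [map_sum, Finset.sum_mul, Matrix.trace_sum]
  rw [Matrix.trace]
  refine Finset.sum_congr rfl fun i _ => ?_
  rw [Matrix.diag_apply, Matrix.mul_apply]
  refine Finset.sum_congr rfl fun j _ => ?_
  have : Matrix.single i j (X i j) = X i j • Matrix.single i j (1 : ℂ) := by simp
  rw [this, map_smul, Matrix.smul_mul, Matrix.trace_smul]
  rfl

lemma chan_schwarz {n m : ℕ} {Φ : Matrix (Fin n) (Fin n) ℂ →ₗ[ℂ] Matrix (Fin m) (Fin m) ℂ}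
    (hΦ : IsQuantumChannel Φ) {σ : Matrix (Fin n) (Fin n) ℂ} (hσ : σ.PosSemidef)
    (Z : Matrix (Fin n) (Fin n) ℂ) (Y : Matrix (Fin m) (Fin m) ℂ)
    (hZ : ∀ X, (Φ X * Y).trace = (X * Z).trace) :
    (Zᴴ * σ * Z).trace.re ≤ (Yᴴ * Φ σ * Y).trace.re := by
  have h := chan_sum_nonneg hΦ.1 hσ ![Z, 1] ![1, -Y]
  have e1 : (Φ (Zᴴ * σ) * Y).trace = (Zᴴ * σ * Z).trace := hZ _
  have e2 : (Yᴴ * Φ (σ * Z)).trace = star (Φ (Zᴴ * σ) * Y).trace := by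
    rw [← Matrix.trace_conjTranspose, Matrix.conjTranspose_mul, ← chan_conjTranspose hΦ.1,
      Matrix.conjTranspose_mul, Matrix.conjTranspose_conjTranspose, hσ.1.eq]
  have h' := (Complex.le_def.1 h).1
  simp [Fin.sum_univ_two, e1, e2, hΦ.2] at h'
  linarith

lemma chan_functional {n m : ℕ} {Φ : Matrix (Fin n) (Fin n) ℂ →ₗ[ℂ] Matrix (Fin m) (Fin m) ℂ}
    (hΦ : IsQuantumChannel Φ) {ρ σ : Matrix (Fin n) (Fin n) ℂ} (hρ : ρ.PosSemidef)
    (hσ : σ.PosSemidef) (Y : Matrix (Fin m) (Fin m) ℂ) : ∃ Z : Matrix (Fin n) (Fin n) ℂ,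
    (Yᴴ * Φ ρ).trace.re = (Zᴴ * ρ).trace.re ∧
    (Zᴴ * σ * Z).trace.re ≤ (Yᴴ * Φ σ * Y).trace.re ∧
    (Z * ρ * Zᴴ).trace.re ≤ (Y * Φ ρ * Yᴴ).trace.re := by
  have key : ∀ X, (Φ X * Yᴴ).trace = (X * (dual Φ Y)ᴴ).trace := by
    intro X
    have := dual_spec Φ Xᴴ Y
    rw [chan_conjTranspose hΦ.1] at this
    have h2 := congrArg star this
    rw [← Matrix.trace_conjTranspose, ← Matrix.trace_conjTranspose] at h2
    simp only [Matrix.conjTranspose_mul, Matrix.conjTranspose_conjTranspose] at h2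
    rw [Matrix.trace_mul_comm, h2, Matrix.trace_mul_comm]
  refine ⟨dual Φ Y, ?_, chan_schwarz hΦ hσ _ _ (fun X => dual_spec Φ X Y), ?_⟩
  · rw [Matrix.trace_mul_comm, key, Matrix.trace_mul_comm]
  · have := chan_schwarz hΦ hρ _ _ key
    simpa using this

/-- Spectral data. -/
structure Spec {k : Type*} [Fintype k] [DecidableEq k] (X U : Matrix k k ℂ) (p : k → ℝ) : Prop where
  h1 : Uᴴ * U = 1
  h2 : U * Uᴴ = 1
  hX : X = U * diagonal (fun i => (p i : ℂ)) * Uᴴ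

lemma spec_of {k : Type*} [Fintype k] [DecidableEq k] {X : Matrix k k ℂ} (h : X.IsHermitian) :
    Spec X (h.eigenvectorUnitary : Matrix k k ℂ) h.eigenvalues where
  h1 := Unitary.star_mul_self_of_mem h.eigenvectorUnitary.2
  h2 := Unitary.mul_star_self_of_mem h.eigenvectorUnitary.2
  hX := by
    conv_lhs => rw [h.spectral_theorem, Unitary.conjStarAlgAut_apply]
    rfl

lemma matLog_eq {k : Type*} [Fintype k] [DecidableEq k] {X : Matrix k k ℂ} (h : X.IsHermitian) :
    matLog X = (h.eigenvectorUnitary : Matrix k k ℂ) *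
      diagonal (fun i => ((Real.log (h.eigenvalues i) : ℝ) : ℂ)) *
      (h.eigenvectorUnitary : Matrix k k ℂ)ᴴ := by
  rw [matLog, dif_pos h, Matrix.IsHermitian.cfc, Unitary.conjStarAlgAut_apply]
  congr 3
  ext i
  simp only [Function.comp_apply]
  split_ifs with h0 <;> simp [h0]

lemma trace_diag_form {k : Type*} [Fintype k] [DecidableEq k] (C x : Matrix k k ℂ) (p : k → ℝ) :
    (xᴴ * C * diagonal (fun i => (p i : ℂ))).trace.re
      = ∑ i, ∑ j, p i * (star (x j i) * C j i).re := by
  simp only [Matrix.trace, Matrix.diag_apply, Matrix.mul_diagonal]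
  simp only [Complex.re_sum, Matrix.mul_apply, Finset.sum_mul, Matrix.conjTranspose_apply]
  refine Finset.sum_congr rfl fun i _ => Finset.sum_congr rfl fun j _ => ?_
  rw [Complex.re_mul_ofReal, mul_comm]

lemma trace_left {k : Type*} [Fintype k] [DecidableEq k] (x : Matrix k k ℂ) (q : k → ℝ) :
    (xᴴ * diagonal (fun i => (q i : ℂ)) * x).trace.re
      = ∑ i, ∑ j, q j * Complex.normSq (x j i) := by
  simp only [Matrix.trace, Matrix.diag, Complex.re_sum, Matrix.mul_apply,
    Matrix.conjTranspose_apply]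
  refine Finset.sum_congr rfl fun i _ => ?_
  simp [Matrix.diagonal_apply]
  refine Finset.sum_congr rfl fun j _ => ?_
  rw [Complex.normSq_apply]; ring

lemma trace_right {k : Type*} [Fintype k] [DecidableEq k] (x : Matrix k k ℂ) (p : k → ℝ) :
    (x * diagonal (fun i => (p i : ℂ)) * xᴴ).trace.re
      = ∑ i, ∑ j, p i * Complex.normSq (x j i) := by
  have := trace_left xᴴ p
  rw [Matrix.conjTranspose_conjTranspose] at this
  rw [this, Finset.sum_comm]
  simp [Complex.normSq_conj]

/-- overlaps -/
noncomputable def ov {k : Type*} [Fintype k] (U V : Matrix k k ℂ) (i j : k) : ℝ :=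
  Complex.normSq ((Vᴴ * U) j i)

lemma ov_nonneg {k : Type*} [Fintype k] (U V : Matrix k k ℂ) (i j : k) : 0 ≤ ov U V i j :=
  Complex.normSq_nonneg _

lemma trace_mul_diags {k : Type*} [Fintype k] [DecidableEq k] (U V : Matrix k k ℂ) (p q : k → ℝ) :
    ((U * diagonal (fun i => (p i : ℂ)) * Uᴴ) * (V * diagonal (fun i => (q i : ℂ)) * Vᴴ)).trace.re
      = ∑ i, ∑ j, ov U V i j * p i * q j := by
  have e : ((U * diagonal (fun i => (p i : ℂ)) * Uᴴ) *
      (V * diagonal (fun i => (q i : ℂ)) * Vᴴ)).trace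
      = ((Vᴴ * U)ᴴ * (diagonal (fun i => (q i : ℂ)) * (Vᴴ * U)) *
        diagonal (fun i => (p i : ℂ))).trace := by
    rw [Matrix.trace_mul_comm _ (diagonal (fun i => (p i : ℂ))), Matrix.conjTranspose_mul,
      Matrix.conjTranspose_conjTranspose, Matrix.mul_assoc, Matrix.mul_assoc,
      Matrix.trace_mul_comm U]
    simp only [Matrix.mul_assoc]
  rw [e, trace_diag_form]
  refine Finset.sum_congr rfl fun i _ => Finset.sum_congr rfl fun j _ => ?_
  rw [Matrix.diagonal_mul, ov, Complex.normSq_apply]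
  simp
  ring

/-- F_t -/
noncomputable def F {k : Type*} [Fintype k] (U V : Matrix k k ℂ) (p q : k → ℝ) (t : ℝ) : ℝ :=
  ∑ i, ∑ j, ov U V i j * (p i ^ 2 / (q j + t * p i))

noncomputable def Q {k : Type*} [Fintype k] (ρ σ X : Matrix k k ℂ) (t : ℝ) : ℝ :=
  2 * (Xᴴ * ρ).trace.re - (Xᴴ * σ * X).trace.re - t * (X * ρ * Xᴴ).trace.re

lemma Q_eq {k : Type*} [Fintype k] [DecidableEq k] {ρ σ U V : Matrix k k ℂ} {p q : k → ℝ}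
    (hρ : Spec ρ U p) (hσ : Spec σ V q) (x : Matrix k k ℂ) (t : ℝ) :
    Q ρ σ (V * x * Uᴴ) t = ∑ i, ∑ j, (2 * (p i * (star (x j i) * (Vᴴ * U) j i).re)
      - q j * Complex.normSq (x j i) - t * (p i * Complex.normSq (x j i))) := by
  have a1 : ((V * x * Uᴴ)ᴴ * ρ).trace = (xᴴ * (Vᴴ * U) * diagonal (fun i => (p i : ℂ))).trace := by
    rw [hρ.hX]
    simp only [Matrix.conjTranspose_mul, Matrix.conjTranspose_conjTranspose, Matrix.mul_assoc]
    rw [Matrix.trace_mul_comm]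
    simp only [Matrix.mul_assoc, hρ.h1, Matrix.mul_one]
  have a2 : ((V * x * Uᴴ)ᴴ * σ * (V * x * Uᴴ)).trace
      = (xᴴ * diagonal (fun i => (q i : ℂ)) * x).trace := by
    have : (V * x * Uᴴ)ᴴ * σ * (V * x * Uᴴ)
      = U * (xᴴ * (Vᴴ * V) * diagonal (fun i => (q i : ℂ)) * (Vᴴ * V) * x) * Uᴴ := by
      rw [hσ.hX]
      simp only [Matrix.conjTranspose_mul, Matrix.conjTranspose_conjTranspose, Matrix.mul_assoc]
    rw [this, Matrix.trace_mul_comm, ← Matrix.mul_assoc, hρ.h1, hσ.h1]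
    simp
  have a3 : ((V * x * Uᴴ) * ρ * (V * x * Uᴴ)ᴴ).trace
      = (x * diagonal (fun i => (p i : ℂ)) * xᴴ).trace := by
    have : (V * x * Uᴴ) * ρ * (V * x * Uᴴ)ᴴ
      = V * (x * (Uᴴ * U) * diagonal (fun i => (p i : ℂ)) * (Uᴴ * U) * xᴴ) * Vᴴ := by
      rw [hρ.hX]
      simp only [Matrix.conjTranspose_mul, Matrix.conjTranspose_conjTranspose, Matrix.mul_assoc]
    rw [this, Matrix.trace_mul_comm, ← Matrix.mul_assoc, hρ.h1, hσ.h1]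
    simp
  rw [Q, a1, a2, a3, trace_diag_form, trace_left, trace_right]
  simp only [Finset.mul_sum, Finset.sum_sub_distrib]

lemma Q_le {k : Type*} [Fintype k] [DecidableEq k] {ρ σ U V : Matrix k k ℂ} {p q : k → ℝ}
    (hρ : Spec ρ U p) (hσ : Spec σ V q) (hp : ∀ i, 0 ≤ p i) (hq : ∀ i, 0 ≤ q i)
    (X : Matrix k k ℂ) {t : ℝ} (ht : 0 < t) : Q ρ σ X t ≤ F U V p q t := by
  have : X = V * (Vᴴ * X * U) * Uᴴ := by
    have : V * (Vᴴ * X * U) * Uᴴ = (V * Vᴴ) * X * (U * Uᴴ) := by simp only [Matrix.mul_assoc]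
    rw [this, hρ.h2, hσ.h2]; simp
  rw [this, Q_eq hρ hσ, F]
  refine Finset.sum_le_sum fun i _ => Finset.sum_le_sum fun j _ => ?_
  generalize (Vᴴ * X * U) j i = z
  rw [ov]
  generalize (Vᴴ * U) j i = c
  rw [Complex.normSq_apply, Complex.normSq_apply]
  simp only [Complex.star_def, Complex.mul_re, Complex.conj_re, Complex.conj_im]
  rcases (hp i).eq_or_lt with h | h
  · rw [← h]
    simp
    have := hq j
    nlinarith [mul_nonneg this (mul_self_nonneg z.re), mul_nonneg this (mul_self_nonneg z.im)]
  · have hs : 0 < q j + t * p i := by have := hq j; positivity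
    rw [← mul_div_assoc, le_div_iff₀ hs]
    nlinarith [sq_nonneg ((q j + t * p i) * z.re - p i * c.re),
      sq_nonneg ((q j + t * p i) * z.im - p i * c.im)]

lemma exists_Q_eq {k : Type*} [Fintype k] [DecidableEq k] {ρ σ U V : Matrix k k ℂ} {p q : k → ℝ}
    (hρ : Spec ρ U p) (hσ : Spec σ V q) (hp : ∀ i, 0 ≤ p i) (hq : ∀ i, 0 ≤ q i)
    {t : ℝ} (ht : 0 < t) : ∃ X, Q ρ σ X t = F U V p q t := by
  refine ⟨V * (Matrix.of fun j i => ((p i / (q j + t * p i) : ℝ) : ℂ) * (Vᴴ * U) j i) * Uᴴ, ?_⟩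
  rw [Q_eq hρ hσ, F]
  refine Finset.sum_congr rfl fun i _ => Finset.sum_congr rfl fun j _ => ?_
  rw [Matrix.of_apply, ov]
  generalize (Vᴴ * U) j i = c
  rw [Complex.normSq_apply, Complex.normSq_apply]
  simp only [Complex.star_def, Complex.mul_re, Complex.conj_re, Complex.conj_im, Complex.mul_im,
    Complex.ofReal_re, Complex.ofReal_im]
  rcases (hp i).eq_or_lt with h | h
  · rw [← h]
    simp
  · have hs : 0 < q j + t * p i := by have := hq j; positivity
    have hr : p i / (q j + t * p i) * (q j + t * p i) = p i := div_mul_cancel₀ _ hs.ne'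
    have e : p i ^ 2 / (q j + t * p i) = p i / (q j + t * p i) * p i := by ring
    rw [e]
    generalize p i / (q j + t * p i) = r at hr
    linear_combination (-r * (c.re * c.re + c.im * c.im)) * hr

lemma F_mono {n m : ℕ} {Φ : Matrix (Fin n) (Fin n) ℂ →ₗ[ℂ] Matrix (Fin m) (Fin m) ℂ}
    (hΦ : IsQuantumChannel Φ) {ρ σ U V : Matrix (Fin n) (Fin n) ℂ} {p q : Fin n → ℝ}
    (pρ : ρ.PosSemidef) (pσ : σ.PosSemidef)
    (hρ : Spec ρ U p) (hσ : Spec σ V q) (hp : ∀ i, 0 ≤ p i) (hq : ∀ i, 0 ≤ q i)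
    {U' V' : Matrix (Fin m) (Fin m) ℂ} {p' q' : Fin m → ℝ}
    (hρ' : Spec (Φ ρ) U' p') (hσ' : Spec (Φ σ) V' q') (hp' : ∀ i, 0 ≤ p' i) (hq' : ∀ i, 0 ≤ q' i)
    {t : ℝ} (ht : 0 < t) : F U' V' p' q' t ≤ F U V p q t := by
  obtain ⟨Y, hY⟩ := exists_Q_eq hρ' hσ' hp' hq' ht
  obtain ⟨Z, h1, h2, h3⟩ := chan_functional hΦ pρ pσ Y
  rw [← hY]
  refine le_trans ?_ (Q_le hρ hσ hp hq Z ht)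
  rw [Q, Q, h1]
  have := mul_le_mul_of_nonneg_left h3 ht.le
  linarith


lemma trace_spec {k : Type*} [Fintype k] [DecidableEq k] (U V : Matrix k k ℂ) (p : k → ℝ)
    (hV : V * Vᴴ = 1) :
    (U * diagonal (fun i => (p i : ℂ)) * Uᴴ).trace.re = ∑ i, ∑ j, ov U V i j * p i := by
  have := trace_mul_diags U V p (fun _ => 1)
  simpa [hV] using this

/-- Relative entropy. -/
noncomputable def R {k : Type*} [Fintype k] [DecidableEq k] (ρ σ : Matrix k k ℂ) : ℝ :=
  (ρ * matLog ρ).trace.re - (ρ * matLog σ).trace.re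

lemma R_eq {k : Type*} [Fintype k] [DecidableEq k] {ρ σ : Matrix k k ℂ}
    (hρ : ρ.IsHermitian) (hσ : σ.IsHermitian) :
    R ρ σ = ∑ i, ∑ j, ov (hρ.eigenvectorUnitary : Matrix k k ℂ) hσ.eigenvectorUnitary i j *
      (hρ.eigenvalues i * (Real.log (hρ.eigenvalues i) - Real.log (hσ.eigenvalues j))) := by
  have sρ := spec_of hρ
  have sσ := spec_of hσ
  have e1 : ρ * matLog ρ = (hρ.eigenvectorUnitary : Matrix k k ℂ) *
      diagonal (fun i => ((hρ.eigenvalues i * Real.log (hρ.eigenvalues i) : ℝ) : ℂ)) *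
      (hρ.eigenvectorUnitary : Matrix k k ℂ)ᴴ := by
    rw [matLog_eq hρ]
    generalize hρ.eigenvalues = p at *
    generalize (hρ.eigenvectorUnitary : Matrix k k ℂ) = U at *
    rw [sρ.hX]
    have : ∀ A B : Matrix k k ℂ, U * A * Uᴴ * (U * B * Uᴴ) = U * (A * (Uᴴ * U) * B) * Uᴴ := by
      intro A B; simp only [Matrix.mul_assoc]
    rw [this, sρ.h1, Matrix.mul_one, Matrix.diagonal_mul_diagonal]
    simp
  have e2 : (ρ * matLog σ).trace.re = ∑ i, ∑ j,
      ov (hρ.eigenvectorUnitary : Matrix k k ℂ) hσ.eigenvectorUnitary i j *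
      hρ.eigenvalues i * Real.log (hσ.eigenvalues j) := by
    rw [← trace_mul_diags, ← sρ.hX, ← matLog_eq hσ]
  rw [R, e1, trace_spec _ _ _ sσ.h2, e2]
  simp only [← Finset.sum_sub_distrib]
  refine Finset.sum_congr rfl fun i _ => Finset.sum_congr rfl fun j _ => ?_
  ring

lemma supp_of {k : Type*} [Fintype k] [DecidableEq k] {ρ σ U V : Matrix k k ℂ} {p q : k → ℝ}
    (hρ : Spec ρ U p) (hσ : Spec σ V q) (hp : ∀ i, 0 ≤ p i) {c : ℝ} (hc : 0 < c)
    (h : (σ - (c : ℂ) • ρ).PosSemidef) (i j : k) (hij : ov U V i j * p i ≠ 0) : q j ≠ 0 := by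
  intro hq
  have h1 := (h.conjTranspose_mul_mul_same V).diag_nonneg (i := j)
  have e1 : Vᴴ * (σ - (c : ℂ) • ρ) * V = (Vᴴ * V) * diagonal (fun i => (q i : ℂ)) * (Vᴴ * V) -
      (c : ℂ) • ((Vᴴ * U) * diagonal (fun i => (p i : ℂ)) * (Vᴴ * U)ᴴ) := by
    rw [hσ.hX, hρ.hX]
    simp only [Matrix.mul_sub, Matrix.sub_mul, Matrix.mul_smul, Matrix.smul_mul,
      Matrix.conjTranspose_mul, Matrix.conjTranspose_conjTranspose, Matrix.mul_assoc]
  have e2 : ((Vᴴ * U) * diagonal (fun i => (p i : ℂ)) * (Vᴴ * U)ᴴ) j j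
      = ((∑ i, ov U V i j * p i : ℝ) : ℂ) := by
    rw [Matrix.mul_apply, Complex.ofReal_sum]
    refine Finset.sum_congr rfl fun i _ => ?_
    rw [Matrix.mul_diagonal, Matrix.conjTranspose_apply, ov, Complex.ofReal_mul,
      Complex.normSq_eq_conj_mul_self, Complex.star_def]
    ring
  rw [e1, hσ.h1] at h1
  simp only [Matrix.one_mul, Matrix.mul_one, Matrix.sub_apply, Matrix.smul_apply,
    Matrix.diagonal_apply_eq, hq, e2, smul_eq_mul, ← Complex.ofReal_mul, ← Complex.ofReal_sub,
    Complex.zero_le_real] at h1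
  have h2 : ∑ i, ov U V i j * p i ≤ 0 := by nlinarith
  have h3 := Finset.single_le_sum (f := fun i => ov U V i j * p i)
    (fun i _ => mul_nonneg (ov_nonneg U V i j) (hp i)) (Finset.mem_univ i)
  have h4 := mul_nonneg (ov_nonneg U V i j) (hp i)
  exact hij (le_antisymm (h3.trans h2) h4)

section
variable {k : Type*} [Fintype k]

lemma F_deriv {U V : Matrix k k ℂ} {p q : k → ℝ}
    (hp : ∀ i, 0 ≤ p i) (hq : ∀ i, 0 ≤ q i) (hs : ∀ i j, ov U V i j * p i ≠ 0 → q j ≠ 0)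
    {t : ℝ} (ht : 0 ≤ t) :
    HasDerivAt (fun t => ∑ i, ∑ j, ov U V i j * (p i * Real.log (q j + t * p i)))
      (F U V p q t) t := by
  unfold F
  refine HasDerivAt.fun_sum fun i _ => HasDerivAt.fun_sum fun j _ => ?_
  by_cases h : ov U V i j * p i = 0
  · have e1 : (fun t => ov U V i j * (p i * Real.log (q j + t * p i))) = fun _ => 0 := by
      ext t; rw [← mul_assoc, h, zero_mul]
    have e2 : ov U V i j * (p i ^ 2 / (q j + t * p i)) = 0 := by
      rw [pow_two, mul_div_assoc, ← mul_assoc, h, zero_mul]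
    rw [e1, e2]
    exact hasDerivAt_const _ _
  · have hq' : 0 < q j := lt_of_le_of_ne (hq j) (hs i j h).symm
    have hpos : 0 < q j + t * p i := by have := hp i; positivity
    have d : HasDerivAt (fun t => q j + t * p i) (p i) t := by
      simpa using ((hasDerivAt_id t).mul_const (p i)).const_add (q j)
    have := ((d.log hpos.ne').const_mul (p i)).const_mul (ov U V i j)
    refine this.congr_deriv ?_
    ring

lemma F_cont {U V : Matrix k k ℂ} {p q : k → ℝ}
    (hp : ∀ i, 0 ≤ p i) (hq : ∀ i, 0 ≤ q i) (hs : ∀ i j, ov U V i j * p i ≠ 0 → q j ≠ 0) (T : ℝ) :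
    ContinuousOn (F U V p q) (Set.Icc 0 T) := by
  unfold F
  refine continuousOn_finsetSum _ fun i _ => continuousOn_finsetSum _ fun j _ => ?_
  by_cases h : ov U V i j * p i = 0
  · have e2 : (fun t => ov U V i j * (p i ^ 2 / (q j + t * p i))) = fun _ => 0 := by
      ext t
      rw [pow_two, mul_div_assoc, ← mul_assoc, h, zero_mul]
    rw [e2]
    exact continuousOn_const
  · have hq' : 0 < q j := lt_of_le_of_ne (hq j) (hs i j h).symm
    refine continuousOn_const.mul (continuousOn_const.div (by fun_prop) fun t ht => ?_)
    have := hp i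
    have := ht.1
    positivity

lemma F_int {U V : Matrix k k ℂ} {p q : k → ℝ}
    (hp : ∀ i, 0 ≤ p i) (hq : ∀ i, 0 ≤ q i) (hs : ∀ i j, ov U V i j * p i ≠ 0 → q j ≠ 0)
    {T : ℝ} (hT : 0 < T) :
    IntervalIntegrable (F U V p q) MeasureTheory.volume 0 T ∧
    ∫ t in (0:ℝ)..T, F U V p q t =
      (∑ i, ∑ j, ov U V i j * (p i * (Real.log (q j + T * p i) - Real.log T - Real.log (q j))))
       + Real.log T * ∑ i, ∑ j, ov U V i j * p i := by
  have hI : IntervalIntegrable (F U V p q) MeasureTheory.volume 0 T :=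
    ContinuousOn.intervalIntegrable (by rw [Set.uIcc_of_le hT.le]; exact F_cont hp hq hs T)
  refine ⟨hI, ?_⟩
  rw [intervalIntegral.integral_eq_sub_of_hasDerivAt (f := fun t => ∑ i, ∑ j, ov U V i j *
    (p i * Real.log (q j + t * p i))) (fun t ht => ?_) hI]
  · simp only [Finset.mul_sum, ← Finset.sum_sub_distrib, ← Finset.sum_add_distrib]
    refine Finset.sum_congr rfl fun i _ => Finset.sum_congr rfl fun j _ => ?_
    rw [zero_mul, add_zero]
    ring
  · rw [Set.uIcc_of_le hT.le] at ht
    exact F_deriv hp hq hs ht.1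

open Filter Topology in
lemma G_lim {U V : Matrix k k ℂ} {p q : k → ℝ} (hp : ∀ i, 0 ≤ p i) :
    Tendsto (fun T : ℝ =>
      ∑ i, ∑ j, ov U V i j * (p i * (Real.log (q j + T * p i) - Real.log T - Real.log (q j))))
      atTop (𝓝 (∑ i, ∑ j, ov U V i j * (p i * (Real.log (p i) - Real.log (q j))))) := by
  refine tendsto_finsetSum _ fun i _ => tendsto_finsetSum _ fun j _ => ?_
  rcases (hp i).eq_or_lt with h | h
  · rw [← h]; simp
  · refine Tendsto.const_mul _ (Tendsto.const_mul _ (Tendsto.sub_const ?_ _))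
    have h1 : Tendsto (fun T : ℝ => q j / T + p i) atTop (𝓝 (p i)) := by
      simpa using (tendsto_const_nhds (x := q j)).div_atTop tendsto_id |>.add_const (p i)
    have h2 := h1.log h.ne'
    refine h2.congr' ?_
    filter_upwards [eventually_gt_atTop 0, h1.eventually (lt_mem_nhds h)] with T hT hT2
    have : q j + T * p i = T * (q j / T + p i) := by field_simp
    rw [this, Real.log_mul hT.ne' hT2.ne']
    ring

end

/-- Monotonicity of relative entropy. -/
lemma R_mono {n m : ℕ} {Φ : Matrix (Fin n) (Fin n) ℂ →ₗ[ℂ] Matrix (Fin m) (Fin m) ℂ}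
    (hΦ : IsQuantumChannel Φ) {ρ σ : Matrix (Fin n) (Fin n) ℂ}
    (hρ : ρ.PosSemidef) (hσ : σ.PosSemidef) {c : ℝ} (hc : 0 < c)
    (h : (σ - (c : ℂ) • ρ).PosSemidef) : R (Φ ρ) (Φ σ) ≤ R ρ σ := by
  have hρ' := chan_posSemidef hΦ.1 hρ
  have hσ' := chan_posSemidef hΦ.1 hσ
  have h' := chan_posSemidef hΦ.1 h
  rw [map_sub, map_smul] at h'
  have s := spec_of hρ.1
  have r := spec_of hσ.1
  have s' := spec_of hρ'.1
  have r' := spec_of hσ'.1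
  have a := supp_of s r hρ.eigenvalues_nonneg hc h
  have a' := supp_of s' r' hρ'.eigenvalues_nonneg hc h'
  rw [R_eq hρ.1 hσ.1, R_eq hρ'.1 hσ'.1]
  refine le_of_tendsto_of_tendsto (G_lim hρ'.eigenvalues_nonneg) (G_lim hρ.eigenvalues_nonneg) ?_
  filter_upwards [Filter.eventually_gt_atTop 0] with T hT
  obtain ⟨i1, j1⟩ := F_int hρ.eigenvalues_nonneg hσ.eigenvalues_nonneg a hT
  obtain ⟨i2, j2⟩ := F_int hρ'.eigenvalues_nonneg hσ'.eigenvalues_nonneg a' hT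
  have := intervalIntegral.integral_mono_on_of_le_Ioo hT.le i2 i1 (fun t ht =>
    F_mono hΦ hρ hσ s r hρ.eigenvalues_nonneg hσ.eigenvalues_nonneg s' r'
      hρ'.eigenvalues_nonneg hσ'.eigenvalues_nonneg ht.1)
  rw [j1, j2, ← trace_spec _ _ _ r.h2, ← trace_spec _ _ _ r'.h2, ← s.hX, ← s'.hX, hΦ.2] at this
  linarith

lemma Spec.isHermitian {k : Type*} [Fintype k] [DecidableEq k] {X U : Matrix k k ℂ} {p : k → ℝ}
    (h : Spec X U p) : X.IsHermitian := by
  rw [Matrix.IsHermitian, h.hX]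
  simp only [Matrix.conjTranspose_mul, Matrix.conjTranspose_conjTranspose, Matrix.mul_assoc,
    Matrix.diagonal_conjTranspose]
  congr 3
  ext i
  simp

lemma vNent_eig {k : Type*} [Fintype k] [DecidableEq k] {X : Matrix k k ℂ} (h : X.IsHermitian) :
    vNent X = ∑ i, Real.negMulLog (h.eigenvalues i) := by
  have s := spec_of h
  have e1 : X * matLog X = (h.eigenvectorUnitary : Matrix k k ℂ) *
      diagonal (fun i => ((h.eigenvalues i * Real.log (h.eigenvalues i) : ℝ) : ℂ)) *
      (h.eigenvectorUnitary : Matrix k k ℂ)ᴴ := by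
    rw [matLog_eq h]
    generalize h.eigenvalues = p at *
    generalize (h.eigenvectorUnitary : Matrix k k ℂ) = U at *
    rw [s.hX]
    have : ∀ A B : Matrix k k ℂ, U * A * Uᴴ * (U * B * Uᴴ) = U * (A * (Uᴴ * U) * B) * Uᴴ := by
      intro A B; simp only [Matrix.mul_assoc]
    rw [this, s.h1, Matrix.mul_one, Matrix.diagonal_mul_diagonal]
    simp
  rw [vNent, e1, Matrix.trace_mul_comm, ← Matrix.mul_assoc, s.h1, Matrix.one_mul,
    Matrix.trace_diagonal, Complex.re_sum, ← Finset.sum_neg_distrib]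
  refine Finset.sum_congr rfl fun i _ => ?_
  rw [Complex.ofReal_re, Real.negMulLog, neg_mul]

lemma Spec.vNent_eq {k : Type*} [Fintype k] [DecidableEq k] {X U : Matrix k k ℂ} {p : k → ℝ}
    (h : Spec X U p) : vNent X = ∑ i, Real.negMulLog (p i) := by
  rw [vNent_eig h.isHermitian]
  have h1 := h.isHermitian.roots_charpoly_eq_eigenvalues
  have h2 : X.charpoly = ∏ i, (Polynomial.X - Polynomial.C ((p i : ℝ) : ℂ)) := by
    rw [h.hX, Matrix.charpoly_mul_comm, ← Matrix.mul_assoc, h.h1, Matrix.one_mul,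
      Matrix.charpoly_diagonal]
  rw [h2, Polynomial.roots_prod _ _
    (by simp [Finset.prod_ne_zero_iff, Polynomial.X_sub_C_ne_zero])] at h1
  simp only [Polynomial.roots_X_sub_C, Multiset.bind_singleton] at h1
  have h3 := congrArg (fun M => (Multiset.map (fun z : ℂ => Real.negMulLog z.re) M).sum) h1
  simp only [Multiset.map_map, Function.comp_def] at h3
  exact h3.symm

/-- The spectral projections. -/
noncomputable def proj {n : ℕ} (U : Matrix (Fin n) (Fin n) ℂ) (a : Fin n) :
    Matrix (Fin n) (Fin n) ℂ :=
  Matrix.vecMulVec (fun i => U i a) (fun j => star (U j a))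

lemma proj_posSemidef {n : ℕ} (U : Matrix (Fin n) (Fin n) ℂ) (a : Fin n) :
    (proj U a).PosSemidef := Matrix.posSemidef_vecMulVec_self_star (fun i => U i a)

lemma proj_trace {n : ℕ} {U : Matrix (Fin n) (Fin n) ℂ} (hU : Uᴴ * U = 1) (a : Fin n) :
    (proj U a).trace = 1 := by
  have := congrFun (congrFun hU a) a
  rw [Matrix.mul_apply, Matrix.one_apply_eq] at this
  rw [← this, Matrix.trace]
  refine Finset.sum_congr rfl fun i _ => ?_
  simp [proj, Matrix.vecMulVec_apply, mul_comm]

lemma proj_sum {n : ℕ} {ρ U : Matrix (Fin n) (Fin n) ℂ} {p : Fin n → ℝ} (h : Spec ρ U p) :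
    ρ = ∑ a, (p a : ℂ) • proj U a := by
  rw [h.hX]
  ext i j
  rw [Matrix.mul_apply, Matrix.sum_apply]
  refine Finset.sum_congr rfl fun a _ => ?_
  simp [proj, Matrix.vecMulVec_apply, Matrix.mul_diagonal]
  ring

lemma joint_spec {n m : ℕ} {U : Matrix (Fin n) (Fin n) ℂ} (hU : Uᴴ * U = 1)
    (p : Fin n → ℝ) (τ V : Fin n → Matrix (Fin m) (Fin m) ℂ)
    (q : Fin n → Fin m → ℝ) (hs : ∀ a, Spec (τ a) (V a) (q a)) :
    Spec (∑ a, (p a : ℂ) • (proj U a ⊗ₖ τ a))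
      (Matrix.of fun (x y : Fin n × Fin m) => U x.1 y.1 * V y.1 x.2 y.2)
      (fun y => p y.1 * q y.1 y.2) := by
  have h1 : (Matrix.of fun (x y : Fin n × Fin m) => U x.1 y.1 * V y.1 x.2 y.2)ᴴ *
      (Matrix.of fun (x y : Fin n × Fin m) => U x.1 y.1 * V y.1 x.2 y.2) = 1 := by
    ext ⟨a, j⟩ ⟨b, l⟩
    have e : ((Matrix.of fun (x y : Fin n × Fin m) => U x.1 y.1 * V y.1 x.2 y.2)ᴴ *
      (Matrix.of fun (x y : Fin n × Fin m) => U x.1 y.1 * V y.1 x.2 y.2)) (a, j) (b, l)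
      = (Uᴴ * U) a b * ((V a)ᴴ * V b) j l := by
      simp only [Matrix.mul_apply, Fintype.sum_prod_type, Matrix.conjTranspose_apply,
        Matrix.of_apply, Finset.sum_mul_sum, star_mul']
      refine Finset.sum_congr rfl fun i _ => Finset.sum_congr rfl fun r _ => ?_
      ring
    rw [e, hU]
    by_cases hab : a = b
    · subst hab
      rw [(hs a).h1]
      simp [Matrix.one_apply]
    · simp [Matrix.one_apply, hab]
  refine ⟨h1, mul_eq_one_comm.1 h1, ?_⟩
  ext ⟨i, l⟩ ⟨i', l'⟩
  rw [Matrix.mul_apply, Matrix.sum_apply, Fintype.sum_prod_type]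
  refine Finset.sum_congr rfl fun a _ => ?_
  rw [Matrix.smul_apply, Matrix.kroneckerMap_apply, (hs a).hX, Matrix.mul_apply, smul_eq_mul,
    Finset.mul_sum, Finset.mul_sum]
  refine Finset.sum_congr rfl fun j _ => ?_
  simp [proj, Matrix.vecMulVec_apply, Matrix.mul_diagonal]
  ring

lemma mutInfo_eq {n m : ℕ} {W : Matrix (Fin n) (Fin n) ℂ →ₗ[ℂ] Matrix (Fin m) (Fin m) ℂ}
    (hW : IsQuantumChannel W) {ρ : Matrix (Fin n) (Fin n) ℂ} (hρ : ρ.IsHermitian) :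
    mutInfo ρ W = ∑ a, hρ.eigenvalues a *
      R (W (proj (hρ.eigenvectorUnitary : Matrix (Fin n) (Fin n) ℂ) a)) (W ρ) := by
  have s := spec_of hρ
  have hj : jointState ρ W = ∑ a, (hρ.eigenvalues a : ℂ) •
      (proj (hρ.eigenvectorUnitary : Matrix (Fin n) (Fin n) ℂ) a ⊗ₖ
        W (proj (hρ.eigenvectorUnitary : Matrix (Fin n) (Fin n) ℂ) a)) := by
    rw [jointState, dif_pos hρ]
    rfl
  rw [mutInfo, hj, s.vNent_eq]
  generalize hρ.eigenvalues = p at *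
  generalize (hρ.eigenvectorUnitary : Matrix (Fin n) (Fin n) ℂ) = U at *
  have hh : ∀ a, (W (proj U a)).IsHermitian := fun a =>
    (chan_posSemidef hW.1 (proj_posSemidef U a)).1
  have js := joint_spec s.h1 p (fun a => W (proj U a)) _ _ (fun a => spec_of (hh a))
  have ht : ∀ a, ∑ j, (hh a).eigenvalues j = 1 := by
    intro a
    have := (hh a).trace_eq_sum_eigenvalues
    rw [hW.2, proj_trace s.h1] at this
    have h2 := congrArg Complex.re this
    simpa using h2.symm
  rw [js.vNent_eq, Fintype.sum_prod_type]
  have hv : ∀ a, ∑ j, Real.negMulLog ((hh a).eigenvalues j) = vNent (W (proj U a)) :=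
    fun a => (vNent_eig (hh a)).symm
  simp only [Real.negMulLog_mul, Finset.sum_add_distrib, ← Finset.sum_mul, ← Finset.mul_sum, ht,
    one_mul, hv]
  have e : vNent (W ρ) = -∑ a, p a * (W (proj U a) * matLog (W ρ)).trace.re := by
    rw [vNent]
    congr 1
    generalize hL : matLog (W ρ) = L
    rw [congrArg W (proj_sum s), map_sum, Finset.sum_mul, Matrix.trace_sum, Complex.re_sum]
    refine Finset.sum_congr rfl fun a _ => ?_
    rw [map_smul, Matrix.smul_mul, Matrix.trace_smul, smul_eq_mul, Complex.re_ofReal_mul]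
  rw [e]
  simp only [R, vNent, mul_sub, Finset.sum_sub_distrib, mul_neg, Finset.sum_neg_distrib]
  ring

end QDPI

/-- Quantum Data Processing Inequality: post-processing the output of a quantum channel
`W` by another quantum channel `D` never increases the input–output mutual information:
`I(A; D ∘ W) ≤ I(A; W)`. -/
theorem quantum_data_processing {n m k : ℕ}
    (W : Matrix (Fin n) (Fin n) ℂ →ₗ[ℂ] Matrix (Fin m) (Fin m) ℂ)
    (D : Matrix (Fin m) (Fin m) ℂ →ₗ[ℂ] Matrix (Fin k) (Fin k) ℂ)
    (hW : IsQuantumChannel W) (hD : IsQuantumChannel D)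
    (ρ : Matrix (Fin n) (Fin n) ℂ) (hρ : ρ.PosSemidef) (hρt : ρ.trace = 1) :
    mutInfo ρ (D.comp W) ≤ mutInfo ρ W := by
  have hDW : IsQuantumChannel (D.comp W) := by
    refine ⟨fun r M hM => ?_, fun x => ?_⟩
    · exact hD.1 r _ (hW.1 r M hM)
    · rw [LinearMap.comp_apply, hD.2, hW.2]
  rw [QDPI.mutInfo_eq hDW hρ.1, QDPI.mutInfo_eq hW hρ.1]
  have s := QDPI.spec_of hρ.1
  have hp := hρ.eigenvalues_nonneg
  generalize hρ.1.eigenvalues = p at *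
  generalize (hρ.1.eigenvectorUnitary : Matrix (Fin n) (Fin n) ℂ) = U at *
  refine Finset.sum_le_sum fun a _ => ?_
  rcases (hp a).eq_or_lt with h | h
  · rw [← h]; simp
  · refine mul_le_mul_of_nonneg_left ?_ h.le
    rw [LinearMap.comp_apply, LinearMap.comp_apply]
    refine QDPI.R_mono hD (QDPI.chan_posSemidef hW.1 (QDPI.proj_posSemidef U a))
      (QDPI.chan_posSemidef hW.1 hρ) h ?_
    rw [← map_smul, ← map_sub]
    refine QDPI.chan_posSemidef hW.1 ?_
    have e : ρ - (p a : ℂ) • QDPI.proj U a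
        = ∑ b ∈ Finset.univ.erase a, (p b : ℂ) • QDPI.proj U b := by
      rw [QDPI.proj_sum s, ← Finset.add_sum_erase _ _ (Finset.mem_univ a)]
      simp
    rw [e]
    refine Matrix.posSemidef_sum _ fun b _ => ?_
    exact (QDPI.proj_posSemidef U b).smul (by simpa using hp b)
end

section
/- Holevo's Upper Bound (as a corollary of data processing): let W_* : A₁ → A₂ be a quantum channel and D_* : A₂ → A₃ a measurement, i.e., a trace-preserving completely positive map into a commutative finite-dimensional C*-algebra A₃. Then for any input density operator A, I(A; D_* ∘ W_*) ≤ I(A; W_*). -/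
open Matrix
open scoped ComplexOrder Kronecker

lemma hv_scalar {ι κ : Type*} [Fintype ι] [Fintype κ] (w x y : ι → ℝ) (w' x' y' : κ → ℝ)
    (h : ∀ i, w i = 0 ∨ (0 < x i ∧ 0 < y i)) (h' : ∀ i, w' i = 0 ∨ (0 < x' i ∧ 0 < y' i))
    (hs : ∑ i, w i = ∑ i, w' i)
    (hF : ∀ s : ℝ, 0 < s → s < 1 →
      ∑ i, w' i * (y' i / ((1 - s) * x' i + s * y' i)) ≤
        ∑ i, w i * (y i / ((1 - s) * x i + s * y i))) :
    ∑ i, w' i * (Real.log (y' i) - Real.log (x' i)) ≤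
      ∑ i, w i * (Real.log (y i) - Real.log (x i)) := by
  have pos : ∀ {a b s : ℝ}, 0 < a → 0 < b → s ∈ Set.Icc (0:ℝ) 1 → 0 < (1 - s) * a + s * b := by
    intro a b s ha hb hs
    rcases eq_or_lt_of_le hs.1 with h0 | h0
    · simp [← h0, ha]
    · have := mul_nonneg (sub_nonneg.2 hs.2) ha.le
      have := mul_pos h0 hb
      linarith
  have hc : ∀ {a b c s : ℝ}, (c = 0 ∨ (0 < a ∧ 0 < b)) → s ∈ Set.Icc (0:ℝ) 1 →
      HasDerivAt (fun s : ℝ => c * Real.log ((1 - s) * a + s * b))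
        (c * ((b - a) / ((1 - s) * a + s * b))) s := by
    intro a b c s hcc hs
    rcases hcc with rfl | ⟨ha, hb⟩
    · simpa using hasDerivAt_const s (0:ℝ)
    · have hp := pos ha hb hs
      have h1 : HasDerivAt (fun s : ℝ => (1 - s) * a + s * b) (b - a) s := by
        have := (((hasDerivAt_id s).const_sub 1).mul_const a).add ((hasDerivAt_id s).mul_const b)
        exact this.congr_deriv (by ring)
      exact (h1.log hp.ne').const_mul c
  have key : ∀ {a b c s : ℝ}, (c = 0 ∨ (0 < a ∧ 0 < b)) → 0 < s → s < 1 →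
      c * ((b - a) / ((1 - s) * a + s * b))
        = (1 - s)⁻¹ * (c * (b / ((1 - s) * a + s * b)) - c) := by
    intro a b c s hcc h0 h1
    rcases hcc with rfl | ⟨ha, hb⟩
    · simp
    · have hp := pos ha hb ⟨h0.le, h1.le⟩
      have h2 : (1 - s) ≠ 0 := by linarith
      generalize hd : (1 - s) * a + s * b = d at hp ⊢
      field_simp
      rw [← hd]
      ring
  let g : ℝ → ℝ := fun s => ∑ i, w i * Real.log ((1 - s) * x i + s * y i)
    - ∑ i, w' i * Real.log ((1 - s) * x' i + s * y' i)
  have hg : ∀ s ∈ Set.Icc (0:ℝ) 1, HasDerivAt g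
      (∑ i, w i * ((y i - x i) / ((1 - s) * x i + s * y i))
        - ∑ i, w' i * ((y' i - x' i) / ((1 - s) * x' i + s * y' i))) s := by
    intro s hs
    exact (HasDerivAt.fun_sum fun i _ => hc (h i) hs).sub
      (HasDerivAt.fun_sum fun i _ => hc (h' i) hs)
  have hm : MonotoneOn g (Set.Icc 0 1) := by
    apply monotoneOn_of_deriv_nonneg (convex_Icc 0 1)
    · exact fun s hs => (hg s hs).continuousAt.continuousWithinAt
    · intro s hs
      exact (hg s (interior_subset hs)).differentiableAt.differentiableWithinAt
    · intro s hs
      rw [(hg s (interior_subset hs)).deriv]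
      rw [interior_Icc] at hs
      simp_rw [fun i => key (h i) hs.1 hs.2, fun i => key (h' i) hs.1 hs.2, ← Finset.mul_sum,
        Finset.sum_sub_distrib]
      rw [← mul_sub]
      refine mul_nonneg (inv_nonneg.2 (by linarith [hs.2])) ?_
      linarith [hF s hs.1 hs.2]
  have := hm (by simp) (by simp) (zero_le_one (α := ℝ))
  simp only [g, sub_zero, one_mul, zero_mul, add_zero, sub_self, zero_add] at this
  simp only [mul_sub, Finset.sum_sub_distrib]
  linarith

lemma hv_spec {k : Type*} [Fintype k] [DecidableEq k] {A : Matrix k k ℂ} (hA : A.PosSemidef) :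
    ∃ (U : Matrix k k ℂ) (μ : k → ℝ), U * Uᴴ = 1 ∧ Uᴴ * U = 1 ∧ (∀ i, 0 ≤ μ i) ∧
      A = U * diagonal (fun i => (μ i : ℂ)) * Uᴴ ∧
      matLog A = U * diagonal (fun i => (Real.log (μ i) : ℂ)) * Uᴴ := by
  refine ⟨hA.1.eigenvectorUnitary, hA.1.eigenvalues, ?_, ?_, hA.eigenvalues_nonneg, ?_, ?_⟩
  · exact Unitary.coe_mul_star_self _
  · exact Unitary.coe_star_mul_self _
  · exact hA.1.spectral_theorem
  · have : (fun t : ℝ => if t = 0 then 0 else Real.log t) = Real.log := by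
      ext t; split_ifs with h <;> simp [h]
    rw [matLog, dif_pos hA.1]
    unfold Matrix.IsHermitian.cfc
    rw [this]
    rfl

lemma hv_trace_two {k : Type*} [Fintype k] [DecidableEq k] (U V : Matrix k k ℂ) (f g : k → ℝ) :
    ((U * diagonal (fun i => (f i : ℂ)) * Uᴴ * (V * diagonal (fun i => (g i : ℂ)) * Vᴴ)).trace).re
      = ∑ i, ∑ l, Complex.normSq ((Vᴴ * U) i l) * f l * g i := by
  have h1 : (U * diagonal (fun i => (f i : ℂ)) * Uᴴ * (V * diagonal (fun i => (g i : ℂ)) * Vᴴ)).trace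
      = ((Vᴴ * U) * diagonal (fun i => (f i : ℂ)) * (Vᴴ * U)ᴴ * diagonal (fun i => (g i : ℂ))).trace := by
    rw [conjTranspose_mul, conjTranspose_conjTranspose, ← Matrix.mul_assoc, Matrix.trace_mul_comm]
    simp only [Matrix.mul_assoc]
  rw [h1]
  generalize Vᴴ * U = w
  simp only [Matrix.trace, Matrix.diag_apply, mul_diagonal]
  simp only [Matrix.mul_apply (N := wᴴ), mul_diagonal, Complex.re_sum, Finset.sum_mul, conjTranspose_apply]
  refine Finset.sum_congr rfl fun i _ => Finset.sum_congr rfl fun l _ => ?_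
  simp [Complex.normSq_apply, -mul_eq_mul_right_iff]
  ring

lemma hv_row {k : Type*} [Fintype k] [DecidableEq k] {w : Matrix k k ℂ} (h : wᴴ * w = 1) (l : k) :
    ∑ i, Complex.normSq (w i l) = 1 := by
  have := congrArg Complex.re (congrFun (congrFun h l) l)
  simp only [Matrix.mul_apply, Complex.re_sum, conjTranspose_apply, Matrix.one_apply_eq,
    Complex.one_re] at this
  rw [← this]
  refine Finset.sum_congr rfl fun i _ => ?_
  simp [Complex.normSq_apply]

/-- the quadratic functional -/
noncomputable def hvQ {k : Type*} [Fintype k] (s : ℝ) (A B X : Matrix k k ℂ) : ℝ :=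
  2 * (Xᴴ * A).trace.re - (1 - s) * (Xᴴ * B * X).trace.re - s * (X * A * Xᴴ).trace.re

lemma hv_Q_eq {k : Type*} [Fintype k] [DecidableEq k] (s : ℝ) (U V x : Matrix k k ℂ) (μ lam : k → ℝ)
    (hU : Uᴴ * U = 1) (hV : Vᴴ * V = 1) :
    hvQ s (U * diagonal (fun i => (μ i : ℂ)) * Uᴴ) (V * diagonal (fun i => (lam i : ℂ)) * Vᴴ)
      (V * x * Uᴴ) = ∑ i, ∑ l, (2 * (star (x i l) * (Vᴴ * U) i l).re * μ l
        - ((1 - s) * lam i + s * μ l) * Complex.normSq (x i l)) := by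
  have hU' : ∀ Z : Matrix k k ℂ, Uᴴ * (U * Z) = Z := fun Z => by rw [← Matrix.mul_assoc, hU, one_mul]
  have hV' : ∀ Z : Matrix k k ℂ, Vᴴ * (V * Z) = Z := fun Z => by rw [← Matrix.mul_assoc, hV, one_mul]
  have e1 : ((V * x * Uᴴ)ᴴ * (U * diagonal (fun i => (μ i : ℂ)) * Uᴴ)).trace
      = (xᴴ * ((Vᴴ * U) * diagonal (fun i => (μ i : ℂ)))).trace := by
    simp only [conjTranspose_mul, conjTranspose_conjTranspose, Matrix.mul_assoc]
    rw [Matrix.trace_mul_comm]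
    simp only [Matrix.mul_assoc, hU]
    simp
  have e2 : ((V * x * Uᴴ)ᴴ * (V * diagonal (fun i => (lam i : ℂ)) * Vᴴ) * (V * x * Uᴴ)).trace
      = (xᴴ * (diagonal (fun i => (lam i : ℂ)) * x)).trace := by
    simp only [conjTranspose_mul, conjTranspose_conjTranspose, Matrix.mul_assoc]
    rw [Matrix.trace_mul_comm]
    simp only [Matrix.mul_assoc, hU, hV']
    simp
  have e3 : ((V * x * Uᴴ) * (U * diagonal (fun i => (μ i : ℂ)) * Uᴴ) * (V * x * Uᴴ)ᴴ).trace
      = (x * (diagonal (fun i => (μ i : ℂ)) * xᴴ)).trace := by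
    simp only [conjTranspose_mul, conjTranspose_conjTranspose, Matrix.mul_assoc]
    rw [Matrix.trace_mul_comm]
    simp only [Matrix.mul_assoc, hU', hV]
    simp
  rw [hvQ, e1, e2, e3]
  generalize Vᴴ * U = w
  have f1 : (xᴴ * (w * diagonal (fun i => (μ i : ℂ)))).trace.re
      = ∑ i, ∑ l, (star (x i l) * w i l).re * μ l := by
    rw [Finset.sum_comm]
    simp only [Matrix.trace, Matrix.diag_apply]
    simp only [Matrix.mul_apply (M := xᴴ), mul_diagonal, Complex.re_sum, conjTranspose_apply]
    refine Finset.sum_congr rfl fun i _ => Finset.sum_congr rfl fun l _ => ?_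
    simp
    ring
  have f2 : (xᴴ * (diagonal (fun i => (lam i : ℂ)) * x)).trace.re
      = ∑ i, ∑ l, lam i * Complex.normSq (x i l) := by
    rw [Finset.sum_comm]
    simp only [Matrix.trace, Matrix.diag_apply]
    simp only [Matrix.mul_apply (M := xᴴ), diagonal_mul, Complex.re_sum, conjTranspose_apply]
    refine Finset.sum_congr rfl fun i _ => Finset.sum_congr rfl fun l _ => ?_
    simp [Complex.normSq_apply]
    ring
  have f3 : (x * (diagonal (fun i => (μ i : ℂ)) * xᴴ)).trace.re
      = ∑ i, ∑ l, μ l * Complex.normSq (x i l) := by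
    simp only [Matrix.trace, Matrix.diag_apply]
    simp only [Matrix.mul_apply (M := x), diagonal_mul, Complex.re_sum, conjTranspose_apply]
    refine Finset.sum_congr rfl fun i _ => Finset.sum_congr rfl fun l _ => ?_
    simp [Complex.normSq_apply]
    ring
  rw [f1, f2, f3]
  simp only [Finset.mul_sum, ← Finset.sum_sub_distrib]
  refine Finset.sum_congr rfl fun i _ => Finset.sum_congr rfl fun l _ => ?_
  ring

lemma hv_Q_le {k : Type*} [Fintype k] [DecidableEq k] (s : ℝ) (hs0 : 0 < s) (hs1 : s < 1)
    (U V X : Matrix k k ℂ) (μ lam : k → ℝ) (hμ : ∀ i, 0 ≤ μ i) (hl : ∀ i, 0 ≤ lam i)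
    (hU : Uᴴ * U = 1) (hV : Vᴴ * V = 1) (hU2 : U * Uᴴ = 1) (hV2 : V * Vᴴ = 1) :
    hvQ s (U * diagonal (fun i => (μ i : ℂ)) * Uᴴ) (V * diagonal (fun i => (lam i : ℂ)) * Vᴴ) X
      ≤ ∑ i, ∑ l, Complex.normSq ((Vᴴ * U) i l) * μ l * (μ l / ((1 - s) * lam i + s * μ l)) := by
  have hX : X = V * (Vᴴ * X * U) * Uᴴ := by
    simp only [Matrix.mul_assoc, hU2]
    simp only [← Matrix.mul_assoc, hV2]
    simp
  rw [hX, hv_Q_eq s U V _ μ lam hU hV]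
  refine Finset.sum_le_sum fun i _ => Finset.sum_le_sum fun l _ => ?_
  generalize (Vᴴ * X * U) i l = x
  generalize (Vᴴ * U) i l = w
  have h1 := mul_nonneg (sub_nonneg.2 hs1.le) (hl i)
  have h2 := mul_nonneg hs0.le (hμ l)
  rcases eq_or_lt_of_le (add_nonneg h1 h2) with h0 | h0
  · have : s * μ l = 0 := by linarith
    have : μ l = 0 := by simpa [hs0.ne'] using this
    rw [← h0]
    simp [this]
  · set d := (1 - s) * lam i + s * μ l
    have : Complex.normSq w * μ l * (μ l / d) - (2 * (star x * w).re * μ l - d * Complex.normSq x)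
      = ((μ l * w.re - d * x.re)^2 + (μ l * w.im - d * x.im)^2) / d := by
      field_simp
      simp [Complex.normSq_apply]
      ring
    have : 0 ≤ ((μ l * w.re - d * x.re)^2 + (μ l * w.im - d * x.im)^2) / d := by positivity
    linarith

lemma hv_Q_eq_max {k : Type*} [Fintype k] [DecidableEq k] (s : ℝ)
    (U V : Matrix k k ℂ) (μ lam : k → ℝ)
    (hU : Uᴴ * U = 1) (hV : Vᴴ * V = 1) :
    ∃ X, hvQ s (U * diagonal (fun i => (μ i : ℂ)) * Uᴴ) (V * diagonal (fun i => (lam i : ℂ)) * Vᴴ) X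
      = ∑ i, ∑ l, Complex.normSq ((Vᴴ * U) i l) * μ l * (μ l / ((1 - s) * lam i + s * μ l)) := by
  refine ⟨V * (Matrix.of fun i l => ((μ l / ((1 - s) * lam i + s * μ l) : ℝ) : ℂ) * (Vᴴ * U) i l) * Uᴴ, ?_⟩
  rw [hv_Q_eq s U V _ μ lam hU hV]
  refine Finset.sum_congr rfl fun i _ => Finset.sum_congr rfl fun l _ => ?_
  rw [Matrix.of_apply]
  generalize (Vᴴ * U) i l = w
  set d := (1 - s) * lam i + s * μ l
  rcases eq_or_ne d 0 with h0 | h0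
  · simp [h0]
  · have : (star (((μ l / d : ℝ) : ℂ) * w) * w).re = μ l / d * Complex.normSq w := by
      simp only [Complex.star_def, map_mul, Complex.conj_ofReal, mul_assoc, Complex.re_ofReal_mul]
      simp [Complex.normSq_apply]
    rw [this, map_mul, Complex.normSq_ofReal]
    field_simp
    ring

lemma hv_supp {k : Type*} [Fintype k] [DecidableEq k] {p : ℝ} (hp : 0 < p)
    (U V : Matrix k k ℂ) (μ lam : k → ℝ) (hμ : ∀ i, 0 ≤ μ i) (hl : ∀ i, 0 ≤ lam i)
    (hV : Vᴴ * V = 1)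
    (h : ((V * diagonal (fun i => (lam i : ℂ)) * Vᴴ) -
      (p : ℂ) • (U * diagonal (fun i => (μ i : ℂ)) * Uᴴ)).PosSemidef) (i l : k) :
    Complex.normSq ((Vᴴ * U) i l) * μ l = 0 ∨ (0 < lam i ∧ 0 < μ l) := by
  by_cases hm : μ l = 0
  · simp [hm]
  by_cases hli : lam i = 0
  · left
    have h2 := (h.conjTranspose_mul_mul_same V).diag_nonneg (i := i)
    have e : Vᴴ * ((V * diagonal (fun i => (lam i : ℂ)) * Vᴴ) -
        (p : ℂ) • (U * diagonal (fun i => (μ i : ℂ)) * Uᴴ)) * V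
        = diagonal (fun i => (lam i : ℂ)) - (p : ℂ) • ((Vᴴ * U) * diagonal (fun i => (μ i : ℂ)) * (Vᴴ * U)ᴴ) := by
      simp only [mul_sub, sub_mul, conjTranspose_mul, conjTranspose_conjTranspose,
        Matrix.mul_smul, Matrix.smul_mul, Matrix.mul_assoc, hV]
      simp only [← Matrix.mul_assoc, hV]
      simp
    rw [e] at h2
    generalize Vᴴ * U = w at h2
    have h3 := (Complex.le_def.1 h2).1
    have e2 : ((w * diagonal (fun i => (μ i : ℂ)) * wᴴ) i i) = ((∑ l, Complex.normSq (w i l) * μ l : ℝ) : ℂ) := by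
      simp only [Matrix.mul_apply (N := wᴴ), mul_diagonal, conjTranspose_apply]
      push_cast
      refine Finset.sum_congr rfl fun l _ => ?_
      rw [← Complex.mul_conj]
      simp only [Complex.star_def]
      ring
    rw [Matrix.sub_apply, Matrix.smul_apply, e2, diagonal_apply_eq, hli, smul_eq_mul] at h3
    rw [← Complex.ofReal_mul, ← Complex.ofReal_sub, Complex.ofReal_re, Complex.zero_re] at h3
    have h4 : ∑ l, Complex.normSq (w i l) * μ l ≤ 0 := by
      by_contra hh
      have := mul_pos hp (not_le.1 hh)
      linarith
    have h5 : ∀ l ∈ Finset.univ, 0 ≤ Complex.normSq (w i l) * μ l :=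
      fun l _ => mul_nonneg (Complex.normSq_nonneg _) (hμ l)
    exact (Finset.sum_eq_zero_iff_of_nonneg h5).1 (le_antisymm h4 (Finset.sum_nonneg h5)) l (Finset.mem_univ _)
  · right
    exact ⟨lt_of_le_of_ne (hl i) (Ne.symm hli), lt_of_le_of_ne (hμ l) (Ne.symm hm)⟩

lemma hv_adj {n m : ℕ} (D : Matrix (Fin n) (Fin n) ℂ →ₗ[ℂ] Matrix (Fin m) (Fin m) ℂ)
    (Y : Matrix (Fin m) (Fin m) ℂ) :
    ∃ X : Matrix (Fin n) (Fin n) ℂ, ∀ Z, (D Z * Y).trace = (Z * X).trace := by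
  refine ⟨Matrix.of fun j i => (D (Matrix.single i j 1) * Y).trace, fun Z => ?_⟩
  have hZ : Z = ∑ i, ∑ j, Z i j • Matrix.single i j (1 : ℂ) := by
    conv_lhs => rw [Matrix.matrix_eq_sum_single Z]
    simp [Matrix.smul_single]
  conv_lhs => rw [hZ]
  simp only [map_sum, map_smul, Finset.sum_mul, Matrix.smul_mul, Matrix.trace_sum,
    Matrix.trace_smul, smul_eq_mul]
  simp [Matrix.trace, Matrix.mul_apply]

/-- block matrix `R_aᴴ S R_b` -/
def hvBlk {n m : ℕ} (S : Matrix (Fin n) (Fin n) ℂ) (R : Fin 2 → Matrix (Fin n) (Fin m) ℂ) :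
    Matrix (Fin 2 × Fin m) (Fin 2 × Fin m) ℂ :=
  Matrix.of fun p q => ((R p.1)ᴴ * S * R q.1) p.2 q.2

lemma hvBlk_psd {n m : ℕ} {S : Matrix (Fin n) (Fin n) ℂ} (hS : S.PosSemidef)
    (R : Fin 2 → Matrix (Fin n) (Fin m) ℂ) : (hvBlk S R).PosSemidef := by
  have := hS.conjTranspose_mul_mul_same
    (Matrix.of fun (i : Fin n) (p : Fin 2 × Fin m) => R p.1 i p.2)
  have e : hvBlk S R = (Matrix.of fun (i : Fin n) (p : Fin 2 × Fin m) => R p.1 i p.2)ᴴ * S *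
      (Matrix.of fun (i : Fin n) (p : Fin 2 × Fin m) => R p.1 i p.2) := by
    ext p q
    simp [hvBlk, Matrix.mul_apply]
  rw [e]
  exact this

lemma hv_amp_blk {n m : ℕ} (D : Matrix (Fin n) (Fin n) ℂ →ₗ[ℂ] Matrix (Fin m) (Fin m) ℂ)
    (S : Matrix (Fin n) (Fin n) ℂ) (R : Fin 2 → Matrix (Fin n) (Fin n) ℂ) (a b : Fin 2)
    (p q : Fin m) :
    ampMap D 2 (hvBlk S R) (a, p) (b, q) = D ((R a)ᴴ * S * R b) p q := rfl

lemma hv_star {n m : ℕ} {D : Matrix (Fin n) (Fin n) ℂ →ₗ[ℂ] Matrix (Fin m) (Fin m) ℂ}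
    (hD : IsCompletelyPositive D) (Z : Matrix (Fin n) (Fin n) ℂ) : D Zᴴ = (D Z)ᴴ := by
  have h := (hD 2 _ (hvBlk_psd (Matrix.PosSemidef.one (n := Fin n) (R := ℂ)) ![1, Z])).1
  ext p q
  have := h.apply (1, p) (0, q)
  rw [hv_amp_blk, hv_amp_blk] at this
  simp at this
  rw [conjTranspose_apply, ← this]
  simp

lemma hv_pos {n m : ℕ} {D : Matrix (Fin n) (Fin n) ℂ →ₗ[ℂ] Matrix (Fin m) (Fin m) ℂ}
    (hD : IsCompletelyPositive D) {Z : Matrix (Fin n) (Fin n) ℂ} (hZ : Z.PosSemidef) :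
    (D Z).PosSemidef := by
  have h := (hD 2 _ (hvBlk_psd hZ ![1, 1])).submatrix (fun p : Fin m => ((0 : Fin 2), p))
  convert h using 1
  ext p q
  rw [Matrix.submatrix_apply, hv_amp_blk]
  simp

lemma hv_KS {n m : ℕ} {D : Matrix (Fin n) (Fin n) ℂ →ₗ[ℂ] Matrix (Fin m) (Fin m) ℂ}
    (hD : IsQuantumChannel D) {S : Matrix (Fin n) (Fin n) ℂ} (hS : S.PosSemidef)
    {X : Matrix (Fin n) (Fin n) ℂ} {Y : Matrix (Fin m) (Fin m) ℂ}
    (h1 : ∀ Z, (D Z * Y).trace = (Z * X).trace) (h2 : ∀ Z, (D Z * Yᴴ).trace = (Z * Xᴴ).trace) :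
    (Xᴴ * S * X).trace.re ≤ (Yᴴ * D S * Y).trace.re := by
  have hP := hD.1 2 _ (hvBlk_psd hS ![1, -X])
  have hC := (hP.conjTranspose_mul_mul_same
    (Matrix.of fun (p : Fin 2 × Fin m) (q : Fin m) =>
      (![Y, (1 : Matrix (Fin m) (Fin m) ℂ)] p.1) p.2 q)).trace_nonneg
  set C : Matrix (Fin 2 × Fin m) (Fin m) ℂ := (Matrix.of fun (p : Fin 2 × Fin m) (q : Fin m) =>
      (![Y, (1 : Matrix (Fin m) (Fin m) ℂ)] p.1) p.2 q) with hCdef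
  have e : Cᴴ * ampMap D 2 (hvBlk S ![1, -X]) * C
      = (Yᴴ * D S + D (-(Xᴴ * S))) * Y + (Yᴴ * D (-(S * X)) + D (Xᴴ * S * X)) := by
    have e0 : ∀ (b : Fin 2) (q i : Fin m), (Cᴴ * ampMap D 2 (hvBlk S ![1, -X])) i (b, q)
        = (Yᴴ * D (S * ![1, -X] b) + D (-(Xᴴ * S * ![1, -X] b))) i q := by
      intro b q i
      rw [Matrix.mul_apply, Fintype.sum_prod_type, Fin.sum_univ_two, Matrix.add_apply,
        Matrix.mul_apply]
      simp only [hv_amp_blk, conjTranspose_apply, hCdef, Matrix.of_apply]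
      congr 1
      · simp
      · simp [Matrix.one_apply, apply_ite]
    ext i j
    rw [Matrix.mul_apply, Fintype.sum_prod_type, Fin.sum_univ_two, Matrix.add_apply,
        Matrix.mul_apply]
    simp only [e0]
    simp only [hCdef, Matrix.of_apply]
    congr 1
    · simp
    · simp [Matrix.one_apply]
  rw [e] at hC
  have hre := (Complex.le_def.1 hC).1
  simp only [add_mul, Matrix.trace_add, map_neg, neg_mul, mul_neg, Matrix.trace_neg, h1,
    hD.2] at hre
  rw [Matrix.trace_mul_comm Yᴴ (D (S * X)), h2] at hre
  have e3 : (S * X * Xᴴ).trace = (Xᴴ * S * X).trace := by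
    rw [Matrix.trace_mul_comm, Matrix.mul_assoc]
  rw [e3] at hre
  simp only [Complex.add_re, Complex.neg_re, Complex.zero_re] at hre
  linarith

lemma hv_Q_mono {n m : ℕ} {D : Matrix (Fin n) (Fin n) ℂ →ₗ[ℂ] Matrix (Fin m) (Fin m) ℂ}
    (hD : IsQuantumChannel D) {A B : Matrix (Fin n) (Fin n) ℂ} (hA : A.PosSemidef)
    (hB : B.PosSemidef) (s : ℝ) (hs0 : 0 < s) (hs1 : s < 1) (Y : Matrix (Fin m) (Fin m) ℂ) :
    ∃ X, hvQ s (D A) (D B) Y ≤ hvQ s A B X := by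
  obtain ⟨X, hX⟩ := hv_adj D Y
  have hX' : ∀ Z, (D Z * Yᴴ).trace = (Z * Xᴴ).trace := by
    intro Z
    have h := congrArg star (hX Zᴴ)
    rw [← Matrix.trace_conjTranspose, ← Matrix.trace_conjTranspose, conjTranspose_mul,
      conjTranspose_mul, conjTranspose_conjTranspose, hv_star hD.1, conjTranspose_conjTranspose] at h
    rw [Matrix.trace_mul_comm, h, Matrix.trace_mul_comm]
  refine ⟨X, ?_⟩
  have k1 := hv_KS hD hB hX hX'
  have k2 := hv_KS hD hA hX' (by simpa using hX)
  simp only [conjTranspose_conjTranspose] at k2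
  unfold hvQ
  rw [Matrix.trace_mul_comm Yᴴ, hX', Matrix.trace_mul_comm A]
  have := mul_le_mul_of_nonneg_left k1 (sub_nonneg.2 hs1.le)
  have := mul_le_mul_of_nonneg_left k2 hs0.le
  linarith

/-- relative entropy -/
noncomputable def hvRel {k : Type*} [Fintype k] [DecidableEq k] (A B : Matrix k k ℂ) : ℝ :=
  (A * matLog A).trace.re - (A * matLog B).trace.re

lemma hv_rel_repr {k : Type*} [Fintype k] [DecidableEq k] {A B : Matrix k k ℂ}
    (hA : A.PosSemidef) (hB : B.PosSemidef) {p : ℝ} (hp : 0 < p)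
    (h : (B - (p : ℂ) • A).PosSemidef) :
    ∃ (w x y : k × k → ℝ), (∀ i, w i = 0 ∨ (0 < x i ∧ 0 < y i)) ∧
      ∑ i, w i = A.trace.re ∧
      hvRel A B = ∑ i, w i * (Real.log (y i) - Real.log (x i)) ∧
      ∀ s : ℝ, 0 < s → s < 1 →
        (∀ X, hvQ s A B X ≤ ∑ i, w i * (y i / ((1 - s) * x i + s * y i))) ∧
        ∃ X, hvQ s A B X = ∑ i, w i * (y i / ((1 - s) * x i + s * y i)) := by
  obtain ⟨U, μ, hU2, hU, hμ, eA, lA⟩ := hv_spec hA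
  obtain ⟨V, lam, hV2, hV, hl, eB, lB⟩ := hv_spec hB
  have hw : (Vᴴ * U)ᴴ * (Vᴴ * U) = 1 := by
    rw [conjTranspose_mul, conjTranspose_conjTranspose, Matrix.mul_assoc, ← Matrix.mul_assoc V,
      hV2, one_mul, hU]
  have hr := hv_row hw
  refine ⟨fun i => Complex.normSq ((Vᴴ * U) i.1 i.2) * μ i.2, fun i => lam i.1, fun i => μ i.2,
    ?_, ?_, ?_, ?_⟩
  · rintro ⟨i, l⟩
    exact hv_supp hp U V μ lam hμ hl hV (by rw [← eA, ← eB]; exact h) i l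
  · rw [Fintype.sum_prod_type, Finset.sum_comm]
    simp only [← Finset.sum_mul, hr, one_mul]
    rw [eA, Matrix.mul_assoc, Matrix.trace_mul_comm, Matrix.mul_assoc, hU, mul_one]
    simp [Matrix.trace]
  · have t1 := hv_trace_two U V μ (fun i => Real.log (lam i))
    rw [← eA, ← lB] at t1
    have t2 : (A * matLog A).trace.re = ∑ l, μ l * Real.log (μ l) := by
      rw [lA]
      conv_lhs => rw [eA]
      rw [hv_trace_two U U μ (fun i => Real.log (μ i)), hU]
      refine Finset.sum_congr rfl fun l _ => ?_
      rw [Finset.sum_eq_single l]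
      · simp
      · intro b _ hb
        simp [Matrix.one_apply_ne hb.symm]
      · simp
    rw [hvRel, t1, t2, Fintype.sum_prod_type]
    simp only [mul_sub, Finset.sum_sub_distrib]
    congr 1
    rw [Finset.sum_comm]
    simp only [← Finset.sum_mul, hr, one_mul]
  · intro s hs0 hs1
    rw [Fintype.sum_prod_type, eA, eB]
    exact ⟨fun X => hv_Q_le s hs0 hs1 U V X μ lam hμ hl hU hV hU2 hV2,
      hv_Q_eq_max s U V μ lam hU hV⟩

lemma hv_rel_mono {n m : ℕ} {D : Matrix (Fin n) (Fin n) ℂ →ₗ[ℂ] Matrix (Fin m) (Fin m) ℂ}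
    (hD : IsQuantumChannel D) {A B : Matrix (Fin n) (Fin n) ℂ} (hA : A.PosSemidef)
    (hB : B.PosSemidef) {p : ℝ} (hp : 0 < p) (h : (B - (p : ℂ) • A).PosSemidef) :
    hvRel (D A) (D B) ≤ hvRel A B := by
  obtain ⟨w, x, y, h1, h2, h3, h4⟩ := hv_rel_repr hA hB hp h
  have h' : (D B - (p : ℂ) • D A).PosSemidef := by
    rw [← map_smul, ← map_sub]
    exact hv_pos hD.1 h
  obtain ⟨w', x', y', h1', h2', h3', h4'⟩ := hv_rel_repr (hv_pos hD.1 hA) (hv_pos hD.1 hB) hp h'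
  rw [h3, h3']
  refine hv_scalar w x y w' x' y' h1 h1' (by rw [h2, h2', hD.2]) fun s hs0 hs1 => ?_
  obtain ⟨Y, hY⟩ := (h4' s hs0 hs1).2
  obtain ⟨X, hX⟩ := hv_Q_mono hD hA hB s hs0 hs1 Y
  rw [← hY]
  exact hX.trans ((h4 s hs0 hs1).1 X)

lemma hv_vNent {k : Type*} [Fintype k] [DecidableEq k] (U : Matrix k k ℂ) (d : k → ℝ)
    (hU : Uᴴ * U = 1) (hd : ∀ i, 0 ≤ d i) :
    vNent (U * diagonal (fun i => (d i : ℂ)) * Uᴴ) = ∑ i, Real.negMulLog (d i) := by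
  set M := U * diagonal (fun i => (d i : ℂ)) * Uᴴ with hMdef
  have hM : M.PosSemidef := by
    refine Matrix.PosSemidef.mul_mul_conjTranspose_same (Matrix.PosSemidef.diagonal ?_) U
    intro i
    simpa using hd i
  obtain ⟨V, μ, hV2, hV, hμ, eM, lM⟩ := hv_spec hM
  have hroots : ∀ (W : Matrix k k ℂ) (f : k → ℝ), Wᴴ * W = 1 →
      (W * diagonal (fun i => (f i : ℂ)) * Wᴴ).charpoly.roots
        = Finset.univ.val.map (fun i => (f i : ℂ)) := by
    intro W f hW
    rw [Matrix.charpoly_mul_comm, ← Matrix.mul_assoc, hW, one_mul, Matrix.charpoly_diagonal,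
      Polynomial.roots_prod]
    · simp
    · simp [Finset.prod_ne_zero_iff, Polynomial.X_sub_C_ne_zero]
  have h1 := hroots U d hU
  rw [← hMdef, eM, hroots V μ hV] at h1
  have h2 : ∑ i, Real.negMulLog (μ i) = ∑ i, Real.negMulLog (d i) := by
    have := congrArg (fun s : Multiset ℂ => (s.map (fun z => Real.negMulLog z.re)).sum) h1
    simp only [Multiset.map_map, Function.comp_def, Complex.ofReal_re] at this
    exact this
  rw [← h2, vNent, lM]
  conv_lhs => rw [eM]
  rw [hv_trace_two V V μ (fun i => Real.log (μ i)), hV, ← Finset.sum_neg_distrib]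
  refine Finset.sum_congr rfl fun l _ => ?_
  rw [Finset.sum_eq_single l]
  · simp [Real.negMulLog]
  · intro b _ hb
    simp [Matrix.one_apply_ne hb.symm]
  · simp

/-- eigenprojections -/
noncomputable def hvP {n : ℕ} {ρ : Matrix (Fin n) (Fin n) ℂ} (h : ρ.IsHermitian) (a : Fin n) :
    Matrix (Fin n) (Fin n) ℂ :=
  Matrix.vecMulVec (fun i => (h.eigenvectorUnitary : Matrix (Fin n) (Fin n) ℂ) i a)
          (fun j => star ((h.eigenvectorUnitary : Matrix (Fin n) (Fin n) ℂ) j a))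

lemma hvP_psd {n : ℕ} {ρ : Matrix (Fin n) (Fin n) ℂ} (h : ρ.IsHermitian) (a : Fin n) :
    (hvP h a).PosSemidef :=
  Matrix.posSemidef_vecMulVec_self_star _

lemma hvP_trace {n : ℕ} {ρ : Matrix (Fin n) (Fin n) ℂ} (h : ρ.IsHermitian) (a : Fin n) :
    (hvP h a).trace = 1 := by
  have : (h.eigenvectorUnitary : Matrix (Fin n) (Fin n) ℂ)ᴴ * h.eigenvectorUnitary = 1 :=
    Unitary.coe_star_mul_self _
  have h2 := congrFun (congrFun this a) a
  rw [Matrix.one_apply_eq, Matrix.mul_apply] at h2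
  rw [← h2]
  simp only [Matrix.trace, hvP, Matrix.diag_apply, vecMulVec_apply, conjTranspose_apply]
  exact Finset.sum_congr rfl fun i _ => mul_comm _ _

lemma hvP_sum {n : ℕ} {ρ : Matrix (Fin n) (Fin n) ℂ} (h : ρ.IsHermitian) :
    ρ = ∑ a, (h.eigenvalues a : ℂ) • hvP h a := by
  have hs : ρ = (h.eigenvectorUnitary : Matrix (Fin n) (Fin n) ℂ) *
    diagonal (fun i => (h.eigenvalues i : ℂ)) *
      (h.eigenvectorUnitary : Matrix (Fin n) (Fin n) ℂ)ᴴ := h.spectral_theorem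
  conv_lhs => rw [hs]
  ext i j
  rw [Matrix.mul_apply, Matrix.sum_apply]
  refine Finset.sum_congr rfl fun a _ => ?_
  simp only [mul_diagonal, hvP, Matrix.smul_apply, vecMulVec_apply, conjTranspose_apply, smul_eq_mul]
  ring

lemma hv_joint {n m : ℕ} {ρ : Matrix (Fin n) (Fin n) ℂ}
    (Φ : Matrix (Fin n) (Fin n) ℂ →ₗ[ℂ] Matrix (Fin m) (Fin m) ℂ) (hρ : ρ.PosSemidef)
    (hΦ : ∀ Z : Matrix (Fin n) (Fin n) ℂ, Z.PosSemidef → (Φ Z).PosSemidef)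
    (ht : ∀ Z, (Φ Z).trace = Z.trace) :
    vNent (jointState ρ Φ) = vNent ρ + ∑ a, hρ.1.eigenvalues a * vNent (Φ (hvP hρ.1 a)) := by
  choose V lam hV2 hV hl eV _ using fun a => hv_spec (hΦ _ (hvP_psd hρ.1 a))
  set U : Matrix (Fin n) (Fin n) ℂ := (hρ.1.eigenvectorUnitary : Matrix (Fin n) (Fin n) ℂ) with hUdef
  set p := hρ.1.eigenvalues with hp
  have hU : Uᴴ * U = 1 := Unitary.coe_star_mul_self _
  have hs : ρ = U * diagonal (fun i => (p i : ℂ)) * Uᴴ := hρ.1.spectral_theorem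
  have hp0 : ∀ a, 0 ≤ p a := hρ.eigenvalues_nonneg
  let T : Matrix (Fin n × Fin m) (Fin n × Fin m) ℂ := Matrix.of fun x a => U x.1 a.1 * V a.1 x.2 a.2
  have hT : Tᴴ * T = 1 := by
    ext ⟨a, i⟩ ⟨b, j⟩
    have e1 : (Tᴴ * T) (a, i) (b, j) = (Uᴴ * U) a b * ((V a)ᴴ * V b) i j := by
      simp only [Matrix.mul_apply, Fintype.sum_prod_type, Finset.sum_mul_sum, conjTranspose_apply,
        T, Matrix.of_apply]
      refine Finset.sum_congr rfl fun x _ => Finset.sum_congr rfl fun y _ => ?_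
      simp only [star_mul']
      ring
    rw [e1, hU]
    by_cases hab : a = b
    · subst hab
      rw [hV]
      simp [Matrix.one_apply]
    · simp [Matrix.one_apply, hab]
  have hJ : jointState ρ Φ = T * diagonal (fun a => ((p a.1 * lam a.1 a.2 : ℝ) : ℂ)) * Tᴴ := by
    rw [jointState, dif_pos hρ.1]
    ext ⟨x, y⟩ ⟨x', y'⟩
    rw [Matrix.sum_apply, Matrix.mul_apply, Fintype.sum_prod_type]
    refine Finset.sum_congr rfl fun a _ => ?_
    have e2 : Φ (hvP hρ.1 a) y y' = ∑ i, V a y i * lam a i * star (V a y' i) := by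
      conv_lhs => rw [eV a]
      rw [Matrix.mul_apply]
      simp only [mul_diagonal, conjTranspose_apply]
    rw [Matrix.smul_apply, Matrix.kroneckerMap_apply]
    change _ • (_ * Φ (hvP hρ.1 a) y y') = _
    rw [e2, vecMulVec_apply, smul_eq_mul, Finset.mul_sum, Finset.mul_sum]
    refine Finset.sum_congr rfl fun i _ => ?_
    simp only [mul_diagonal, conjTranspose_apply, T, Matrix.of_apply, star_mul']
    push_cast
    ring
  have hlt : ∀ a, ∑ i, lam a i = 1 := by
    intro a
    have h1 := (ht (hvP hρ.1 a)).trans (hvP_trace hρ.1 a)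
    rw [eV a, Matrix.mul_assoc, Matrix.trace_mul_comm, Matrix.mul_assoc, hV, mul_one] at h1
    simp only [Matrix.trace_diagonal] at h1
    exact_mod_cast h1
  have hr : vNent ρ = ∑ a, Real.negMulLog (p a) := by
    conv_lhs => rw [hs]
    exact hv_vNent U p hU hp0
  have hv : ∀ a, vNent (Φ (hvP hρ.1 a)) = ∑ i, Real.negMulLog (lam a i) := by
    intro a
    conv_lhs => rw [eV a]
    exact hv_vNent (V a) (lam a) (hV a) (hl a)
  rw [hJ, hv_vNent T _ hT (fun a => mul_nonneg (hp0 _) (hl _ _)), hr, Fintype.sum_prod_type,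
    ← Finset.sum_add_distrib]
  refine Finset.sum_congr rfl fun a _ => ?_
  simp only [Real.negMulLog_mul, Finset.sum_add_distrib]
  rw [← Finset.sum_mul, ← Finset.mul_sum, hlt, hv, one_mul]

lemma hv_mutInfo {n m : ℕ} {ρ : Matrix (Fin n) (Fin n) ℂ}
    (Φ : Matrix (Fin n) (Fin n) ℂ →ₗ[ℂ] Matrix (Fin m) (Fin m) ℂ) (hρ : ρ.PosSemidef)
    (hΦ : ∀ Z : Matrix (Fin n) (Fin n) ℂ, Z.PosSemidef → (Φ Z).PosSemidef)
    (ht : ∀ Z, (Φ Z).trace = Z.trace) :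
    mutInfo ρ Φ = ∑ a, hρ.1.eigenvalues a * hvRel (Φ (hvP hρ.1 a)) (Φ ρ) := by
  have h1 : vNent (Φ ρ) =
      - ∑ a, hρ.1.eigenvalues a * (Φ (hvP hρ.1 a) * matLog (Φ ρ)).trace.re := by
    rw [vNent]
    congr 1
    have h2 : Φ ρ = ∑ a, (hρ.1.eigenvalues a : ℂ) • Φ (hvP hρ.1 a) := by
      conv_lhs => rw [hvP_sum hρ.1]
      simp only [map_sum, map_smul]
    generalize matLog (Φ ρ) = L
    rw [h2, Finset.sum_mul, Matrix.trace_sum, Complex.re_sum]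
    refine Finset.sum_congr rfl fun a _ => ?_
    rw [Matrix.smul_mul, Matrix.trace_smul, smul_eq_mul, Complex.re_ofReal_mul]
  rw [mutInfo, hv_joint Φ hρ hΦ ht, h1]
  simp only [hvRel, vNent, mul_sub, mul_neg, Finset.sum_sub_distrib, Finset.sum_neg_distrib]
  ring

/-- Holevo's Upper Bound as a corollary of data processing: if `D` is a measurement,
i.e. a quantum channel whose image lies in a commutative C*-algebra (all outputs
commute), then `I(A; D ∘ W) ≤ I(A; W)`. -/
theorem holevo_upper_bound {n m k : ℕ}
    (W : Matrix (Fin n) (Fin n) ℂ →ₗ[ℂ] Matrix (Fin m) (Fin m) ℂ)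
    (D : Matrix (Fin m) (Fin m) ℂ →ₗ[ℂ] Matrix (Fin k) (Fin k) ℂ)
    (hW : IsQuantumChannel W) (hD : IsQuantumChannel D)
    (hDcomm : ∀ x y : Matrix (Fin m) (Fin m) ℂ, Commute (D x) (D y))
    (ρ : Matrix (Fin n) (Fin n) ℂ) (hρ : ρ.PosSemidef) (hρt : ρ.trace = 1) :
    mutInfo ρ (D.comp W) ≤ mutInfo ρ W := by
  have hpW : ∀ Z : Matrix (Fin n) (Fin n) ℂ, Z.PosSemidef → (W Z).PosSemidef :=
    fun Z hZ => hv_pos hW.1 hZ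
  rw [hv_mutInfo W hρ hpW hW.2, hv_mutInfo (D.comp W) hρ
    (fun Z hZ => hv_pos hD.1 (hpW Z hZ)) (fun Z => (hD.2 (W Z)).trans (hW.2 Z))]
  refine Finset.sum_le_sum fun a _ => ?_
  rcases eq_or_lt_of_le (hρ.eigenvalues_nonneg a) with h0 | h0
  · rw [← h0]
    simp
  · refine mul_le_mul_of_nonneg_left ?_ h0.le
    refine hv_rel_mono hD (hpW _ (hvP_psd hρ.1 a)) (hpW _ hρ) h0 ?_
    rw [← map_smul, ← map_sub]
    refine hpW _ ?_
    have e : ρ - (hρ.1.eigenvalues a : ℂ) • hvP hρ.1 a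
        = ∑ b ∈ Finset.univ.erase a, (hρ.1.eigenvalues b : ℂ) • hvP hρ.1 b := by
      rw [sub_eq_iff_eq_add, Finset.sum_erase_add _ _ (Finset.mem_univ a)]
      exact hvP_sum hρ.1
    rw [e]
    refine Matrix.posSemidef_sum _ fun b _ => (hvP_psd hρ.1 b).smul ?_
    exact_mod_cast hρ.eigenvalues_nonneg b
end
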